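/- With the lattice models of the context: let Θ ∈ {L,R}^r with Θ_i ≠ Θ_{i+1} for some 1 ≤ i ≤ r−1, let μ = (μ₁ > … > μ_r ≥ 0) with μ₁ < Nm and σ ∈ {1,…,m}^r. Then Z^{Θ,N}_{μ,σ}(z₁,…,z_r) = Z^{s_iΘ,N}_{μ,s_iσ}(z₁,…,z_{i−1},z_{i+1},z_i,z_{i+2},…,z_r), where s_i swaps the i-th and (i+1)-th entries of a tuple. -/

import Mathlib

namespace Lattice

/-- Row types: left-moving (`L`) and right-moving (`R`). -/
inductive RowType | L | R
deriving DecidableEq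

/-- An index for the independent indeterminates `X_{i,j}` with `1 ≤ i < j ≤ m`. -/
structure XIdx (m : ℕ) where
  i : ℕ
  j : ℕ
  hi : 1 ≤ i
  hij : i < j
  hj : j ≤ m

/-- The indeterminates `q`, `Φ`, `z₁, …, z_r` and `X_{i,j}` for `1 ≤ i < j ≤ m`. -/
abbrev Vars (m r : ℕ) := Unit ⊕ Unit ⊕ Fin r ⊕ XIdx m

/-- The field of rational functions over `ℚ` in the indeterminates `Vars m r`. -/
abbrev K (m r : ℕ) := FractionRing (MvPolynomial (Vars m r) ℚ)

noncomputable def vr (m r : ℕ) (v : Vars m r) : K m r :=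
  algebraMap (MvPolynomial (Vars m r) ℚ) (K m r) (MvPolynomial.X v)

/-- The indeterminate `q`. -/
noncomputable def qv (m r : ℕ) : K m r := vr m r (Sum.inl ())

/-- The indeterminate `Φ`. -/
noncomputable def Φv (m r : ℕ) : K m r := vr m r (Sum.inr (Sum.inl ()))

/-- The indeterminate `z_t` (`0`-based: `zv m r t` is the row parameter of row `t+1`). -/
noncomputable def zv (m r : ℕ) (t : Fin r) : K m r := vr m r (Sum.inr (Sum.inr (Sum.inl t)))

/-- The indeterminate `X_{i,j}` for `1 ≤ i < j ≤ m`. -/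
noncomputable def Xv (m r : ℕ) (idx : XIdx m) : K m r := vr m r (Sum.inr (Sum.inr (Sum.inr idx)))

/-- `𝔛_{i,j}`: equal to `X_{i,j}` for `i < j`, to `q²X_{j,i}⁻¹` for `i > j`, and to `−q²`
for `i = j` (colors in range `1 ≤ i, j ≤ m`). -/
noncomputable def Xfrak (m r : ℕ) (i j : ℕ) : K m r :=
  if h : 1 ≤ i ∧ i < j ∧ j ≤ m then Xv m r ⟨i, j, h.1, h.2.1, h.2.2⟩
  else if h' : 1 ≤ j ∧ j < i ∧ i ≤ m then
    (qv m r) ^ 2 * (Xv m r ⟨j, i, h'.1, h'.2.1, h'.2.2⟩)⁻¹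
  else -(qv m r) ^ 2

/-- The vertex weight of the configuration `(left, top, right, bottom) = (a,b,c,d)` for a
vertex of row type `ty` with row parameter `z` in a column of column color `c_j`. -/
noncomputable def wtVertex (m r : ℕ) (ty : RowType) (z : K m r) (j : ℕ) (a b c d : ℕ) :
    K m r :=
  match ty with
  | .R =>
      if a = 0 ∧ b = 0 ∧ c = 0 ∧ d = 0 then 1
      else if a ≠ 0 ∧ b = j ∧ c = a ∧ d = j then
        Φv m r * Xfrak m r a j * (if a = j then z else 1)
      else if a = 0 ∧ b = j ∧ c = 0 ∧ d = j then Φv m r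
      else if a ≠ 0 ∧ b = 0 ∧ c = a ∧ d = 0 then (if a = j then z else 1)
      else if a = j ∧ b = 0 ∧ c = 0 ∧ d = j then Φv m r * (1 - (qv m r) ^ 2) * z
      else if a = 0 ∧ b = j ∧ c = j ∧ d = 0 then 1
      else 0
  | .L =>
      if a = 0 ∧ b = 0 ∧ c = 0 ∧ d = 0 then 1
      else if a ≠ 0 ∧ b = j ∧ c = a ∧ d = j then
        Φv m r * Xfrak m r j a * (if a = j then z⁻¹ else 1)
      else if a = 0 ∧ b = j ∧ c = 0 ∧ d = j then Φv m r
      else if a ≠ 0 ∧ b = 0 ∧ c = a ∧ d = 0 then (if a = j then z⁻¹ else 1)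
      else if a = 0 ∧ b = 0 ∧ c = j ∧ d = j then Φv m r * (1 - (qv m r) ^ 2)
      else if a = j ∧ b = j ∧ c = 0 ∧ d = 0 then z⁻¹
      else 0

/-- A state: spins on horizontal and vertical edges of the grid with `r` rows and `Nc`
columns. -/
abbrev St (m r Nc : ℕ) :=
  (Fin r → Fin (Nc + 1) → Fin (m + 1)) × (Fin (r + 1) → Fin Nc → Fin (m + 1))

/-- The column number of the column at position `p` from the left
(columns are numbered `Nc−1, …, 1, 0` from left to right). -/
def colNum (Nc : ℕ) (p : Fin Nc) : ℕ := Nc - 1 - (p : ℕ)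

/-- The column color of the column at position `p`: the column numbered `x` has column
color `c_{m − (x mod m)}`. -/
def colColor (m Nc : ℕ) (p : Fin Nc) : ℕ := m - colNum Nc p % m

/-- The Boltzmann weight of a state, with row types `Θ` and row parameters `w`. -/
noncomputable def wtState (m r Nc : ℕ) (Θ : Fin r → RowType) (w : Fin r → K m r)
    (s : St m r Nc) : K m r :=
  ∏ t : Fin r, ∏ p : Fin Nc,
    wtVertex m r (Θ t) (w t) (colColor m Nc p)
      (s.1 t p.castSucc : ℕ) (s.2 t.castSucc p : ℕ) (s.1 t p.succ : ℕ) (s.2 t.succ p : ℕ)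

/-- The boundary conditions of the system `𝔖^{Θ,N}_{μ,σ}`. -/
def bc (m r Nc : ℕ) (Θ : Fin r → RowType) (μ σ : Fin r → ℕ) (s : St m r Nc) : Prop :=
  (∀ p : Fin Nc,
      (s.2 0 p : ℕ) = if ∃ t : Fin r, μ t = colNum Nc p then colColor m Nc p else 0) ∧
  (∀ p : Fin Nc, s.2 (Fin.last r) p = 0) ∧
  (∀ t : Fin r,
    (Θ t = RowType.R → (s.1 t 0 : ℕ) = 0 ∧ (s.1 t (Fin.last Nc) : ℕ) = σ t) ∧
    (Θ t = RowType.L → (s.1 t (Fin.last Nc) : ℕ) = 0 ∧ (s.1 t 0 : ℕ) = σ t))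

/-- The partition function `Z^{Θ,N}_{μ,σ}(w₁,…,w_r)`: the sum of the weights of all states
satisfying the boundary conditions. -/
noncomputable def Z (m r Nc : ℕ) (Θ : Fin r → RowType) (w : Fin r → K m r)
    (μ σ : Fin r → ℕ) : K m r :=
  ∑ s : St m r Nc,
    @ite _ (bc m r Nc Θ μ σ s) (Classical.propDecidable _) (wtState m r Nc Θ w s) 0

section YangBaxter
variable {F : Type*} [Field F]

/-- `wtVertex` over an arbitrary field, with `P` in place of `Φ` and `X` in place of `𝔛`. -/
def vertexWeight (P q : F) (X : ℕ → ℕ → F) (ty : RowType) (z : F) (j a b c d : ℕ) : F :=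
  match ty with
  | .R =>
      if a = 0 ∧ b = 0 ∧ c = 0 ∧ d = 0 then 1
      else if a ≠ 0 ∧ b = j ∧ c = a ∧ d = j then P * X a j * (if a = j then z else 1)
      else if a = 0 ∧ b = j ∧ c = 0 ∧ d = j then P
      else if a ≠ 0 ∧ b = 0 ∧ c = a ∧ d = 0 then (if a = j then z else 1)
      else if a = j ∧ b = 0 ∧ c = 0 ∧ d = j then P * (1 - q ^ 2) * z
      else if a = 0 ∧ b = j ∧ c = j ∧ d = 0 then 1
      else 0
  | .L =>
      if a = 0 ∧ b = 0 ∧ c = 0 ∧ d = 0 then 1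
      else if a ≠ 0 ∧ b = j ∧ c = a ∧ d = j then P * X j a * (if a = j then z⁻¹ else 1)
      else if a = 0 ∧ b = j ∧ c = 0 ∧ d = j then P
      else if a ≠ 0 ∧ b = 0 ∧ c = a ∧ d = 0 then (if a = j then z⁻¹ else 1)
      else if a = 0 ∧ b = 0 ∧ c = j ∧ d = j then P * (1 - q ^ 2)
      else if a = j ∧ b = j ∧ c = 0 ∧ d = 0 then z⁻¹
      else 0

variable {P q : F} {X : ℕ → ℕ → F} {j : ℕ}

lemma vertexWeight_of_top (ty : RowType) (z : F) {a b c d : ℕ} (h0 : b ≠ 0) (hj : b ≠ j) :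
    vertexWeight P q X ty z j a b c d = 0 := by
  cases ty <;> simp [vertexWeight, h0, hj]

lemma vertexWeight_of_bottom (ty : RowType) (z : F) {a b c d : ℕ} (h0 : d ≠ 0) (hj : d ≠ j) :
    vertexWeight P q X ty z j a b c d = 0 := by
  cases ty <;> simp [vertexWeight, h0, hj]

lemma vertexWeight_zero_zero_R (z : F) (hj : j ≠ 0) (a c : ℕ) :
    vertexWeight P q X .R z j a 0 c 0 = if c = a then (if a = j then z else 1) else 0 := by
  unfold vertexWeight; grind

lemma vertexWeight_occ_occ_R (z : F) (hj : j ≠ 0) (a c : ℕ) :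
    vertexWeight P q X .R z j a j c j =
      if c = a then (if a = 0 then P else P * X a j * (if a = j then z else 1)) else 0 := by
  unfold vertexWeight; grind

lemma vertexWeight_zero_occ_R (z : F) (hj : j ≠ 0) (a c : ℕ) :
    vertexWeight P q X .R z j a 0 c j =
      if a = j then (if c = 0 then P * (1 - q ^ 2) * z else 0) else 0 := by
  unfold vertexWeight; grind

lemma vertexWeight_occ_zero_R (z : F) (hj : j ≠ 0) (a c : ℕ) :
    vertexWeight P q X .R z j a j c 0 = if a = 0 then (if c = j then 1 else 0) else 0 := by
  unfold vertexWeight; grind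

lemma vertexWeight_zero_zero_L (z : F) (hj : j ≠ 0) (a c : ℕ) :
    vertexWeight P q X .L z j a 0 c 0 = if c = a then (if a = j then z⁻¹ else 1) else 0 := by
  unfold vertexWeight; grind

lemma vertexWeight_occ_occ_L (z : F) (hj : j ≠ 0) (a c : ℕ) :
    vertexWeight P q X .L z j a j c j =
      if c = a then (if a = 0 then P else P * X j a * (if a = j then z⁻¹ else 1)) else 0 := by
  unfold vertexWeight; grind

lemma vertexWeight_zero_occ_L (z : F) (hj : j ≠ 0) (a c : ℕ) :
    vertexWeight P q X .L z j a 0 c j =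
      if a = 0 then (if c = j then P * (1 - q ^ 2) else 0) else 0 := by
  unfold vertexWeight; grind

lemma vertexWeight_occ_zero_L (z : F) (hj : j ≠ 0) (a c : ℕ) :
    vertexWeight P q X .L z j a j c 0 = if a = j then (if c = 0 then z⁻¹ else 0) else 0 := by
  unfold vertexWeight; grind

/-- The weight of two vertically adjacent vertices, of type `R` with spins `a`, `c` above type `L`
with spins `b`, `d`, summed over the spin of the edge between them. -/
def columnRL (P q : F) (X : ℕ → ℕ → F) (m : ℕ) (x y : F) (j t s a b c d : ℕ) : F :=
  ∑ k ∈ Finset.range (m + 1),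
    vertexWeight P q X .R x j a t c k * vertexWeight P q X .L y j b k d s

/-- The weight of two vertically adjacent vertices, of type `L` with spins `b`, `d` above type `R`
with spins `a`, `c`, summed over the spin of the edge between them. -/
def columnLR (P q : F) (X : ℕ → ℕ → F) (m : ℕ) (x y : F) (j t s a b c d : ℕ) : F :=
  ∑ k ∈ Finset.range (m + 1),
    vertexWeight P q X .L y j b t d k * vertexWeight P q X .R x j a k c s

lemma columnRL_eq {m : ℕ} (x y : F) (hj : j ≠ 0) (hjm : j ≤ m) (t s a b c d : ℕ) :
    columnRL P q X m x y j t s a b c d =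
      vertexWeight P q X .R x j a t c 0 * vertexWeight P q X .L y j b 0 d s +
      vertexWeight P q X .R x j a t c j * vertexWeight P q X .L y j b j d s := by
  refine Finset.sum_eq_add_of_mem 0 j (by simp) (by simp; omega) hj.symm ?_
  rintro k - ⟨h0, h1⟩
  rw [vertexWeight_of_bottom _ _ h0 h1, zero_mul]

lemma columnLR_eq {m : ℕ} (x y : F) (hj : j ≠ 0) (hjm : j ≤ m) (t s a b c d : ℕ) :
    columnLR P q X m x y j t s a b c d =
      vertexWeight P q X .L y j b t d 0 * vertexWeight P q X .R x j a 0 c s +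
      vertexWeight P q X .L y j b t d j * vertexWeight P q X .R x j a j c s := by
  refine Finset.sum_eq_add_of_mem 0 j (by simp) (by simp; omega) hj.symm ?_
  rintro k - ⟨h0, h1⟩
  rw [vertexWeight_of_bottom _ _ h0 h1, zero_mul]

/-- The weight of the crossing that takes the pair of spins `(a, a)` to `(c, c)`; `κ` is the
position of a color in the cyclic order. -/
def crossBlock (P q x y : F) (n : ℕ) (κ : ℕ → ℕ) (a c : ℕ) : F :=
  if a = 0 then
    if c = 0 then P * ((q ^ 2) ^ (n + 2) * x - y) else (q ^ 2 - 1) * y * (q ^ 2) ^ (n - κ c)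
  else if c = 0 then (q ^ 2 - 1) * x * (q ^ 2) ^ κ a
  else if a = c then (y - (q ^ 2) ^ n * x) / P
  else if κ a < κ c then (q ^ 2 - 1) * x * (q ^ 2) ^ (n - (κ c - κ a)) / P
  else (q ^ 2 - 1) * y * (q ^ 2) ^ (κ a - κ c - 1) / P

/-- The weight of the crossing that takes the pair of distinct spins `(a, b)` to itself. -/
def crossDiag (P q : F) (X : ℕ → ℕ → F) (x y : F) (n a b : ℕ) : F :=
  if a = 0 ∨ b = 0 then (q ^ 2) ^ (n + 1) * x - y
  else ((q ^ 2) ^ (n + 1) * x - y) / (P * X a b)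

/-- The weight of the crossing of an `R`-row and an `L`-row, taking spins `(a, b)` to `(e, f)`. -/
def cross (P q : F) (X : ℕ → ℕ → F) (x y : F) (n : ℕ) (κ : ℕ → ℕ) (a b e f : ℕ) : F :=
  if a = b then (if f = e then crossBlock P q x y n κ a e else 0)
  else if e = a then (if f = b then crossDiag P q X x y n a b else 0) else 0

lemma sum_cross_mul {x y : F} {n m : ℕ} {κ : ℕ → ℕ} {a b : ℕ} (ha : a ≤ m) (hb : b ≤ m)
    (A : ℕ → ℕ → F) :
    ∑ e ∈ Finset.range (m + 1), ∑ f ∈ Finset.range (m + 1), cross P q X x y n κ a b e f * A e f =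
      if a = b then ∑ e ∈ Finset.range (m + 1), crossBlock P q x y n κ a e * A e e
      else crossDiag P q X x y n a b * A a b := by
  unfold cross
  split_ifs with h
  · refine Finset.sum_congr rfl fun e he => ?_
    simp only [ite_mul, zero_mul, Finset.sum_ite_eq', he, if_true]
  · rw [Finset.sum_eq_single_of_mem a (by simp; omega) (by intro e _ he; simp [he]),
      Finset.sum_eq_single_of_mem b (by simp; omega) (by intro e _ he; simp [he])]
    simp

lemma sum_mul_cross {x y : F} {n m : ℕ} {κ : ℕ → ℕ} {c d : ℕ} (hc : c ≤ m) (hd : d ≤ m)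
    (B : ℕ → ℕ → F) :
    ∑ e ∈ Finset.range (m + 1), ∑ f ∈ Finset.range (m + 1), B e f * cross P q X x y n κ e f c d =
      if c = d then ∑ e ∈ Finset.range (m + 1), B e e * crossBlock P q x y n κ e c
      else B c d * crossDiag P q X x y n c d := by
  unfold cross
  by_cases h : c = d
  · subst h
    rw [if_pos rfl]
    refine Finset.sum_congr rfl fun e he => ?_
    rw [Finset.sum_eq_single_of_mem e he]
    · simp
    · intro f _ hf
      rw [if_neg (Ne.symm hf)]
      grind
  · rw [if_neg h, Finset.sum_eq_single_of_mem c (by simp; omega),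
      Finset.sum_eq_single_of_mem d (by simp; omega)]
    · simp [h]
    · intro f _ hf
      grind
    · intro e _ he
      exact Finset.sum_eq_zero fun f _ => by grind

lemma crossBlock_shift_color {x y : F} {n : ℕ} {κ κ' : ℕ → ℕ} (hj : j ≠ 0)
    (hκ : κ j = 0) (hκ' : κ' j = n) {c : ℕ} (hc : c ≠ 0) (hcj : c ≠ j)
    (hs : κ c = κ' c + 1) (hn : κ' c < n) :
    ∃ U V : F,
      (crossBlock P q x y n κ 0 c = (q ^ 2 - 1) * y * U ∧
        crossBlock P q x y n κ' 0 c = (q ^ 2 - 1) * y * (q ^ 2 * U)) ∧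
      (crossBlock P q x y n κ j c = (q ^ 2 - 1) * x * U / P ∧
        crossBlock P q x y n κ' j c = (q ^ 2 - 1) * y * U / P) ∧
      (crossBlock P q x y n κ c 0 = (q ^ 2 - 1) * x * (q ^ 2 * V) ∧
        crossBlock P q x y n κ' c 0 = (q ^ 2 - 1) * x * V) ∧
      (crossBlock P q x y n κ c j = (q ^ 2 - 1) * y * V / P ∧
        crossBlock P q x y n κ' c j = (q ^ 2 - 1) * x * V / P) := by
  obtain ⟨l, rfl⟩ : ∃ l, n = κ' c + 1 + l := ⟨n - (κ' c + 1), by omega⟩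
  refine ⟨(q ^ 2) ^ l, (q ^ 2) ^ κ' c, ⟨?_, ?_⟩, ⟨?_, ?_⟩, ⟨?_, ?_⟩, ⟨?_, ?_⟩⟩ <;>
    simp [crossBlock, hc, hj, hcj, hcj.symm, hκ, hκ', hs]
  · rw [show κ' c + 1 + l - κ' c = l + 1 by omega]; simp [pow_succ, mul_comm]
  · rw [if_neg (by omega), show κ' c + 1 + l - κ' c - 1 = l by omega]
  · simp [pow_succ, mul_comm]
  · rw [if_pos (by omega), show κ' c + 1 + l - (κ' c + 1 + l - κ' c) = κ' c by omega]

lemma crossBlock_shift_of_color {x y : F} {n : ℕ} {κ κ' : ℕ → ℕ} {a c : ℕ} (ha : a ≠ 0)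
    (hc : c ≠ 0) (hsa : κ a = κ' a + 1) (hsc : κ c = κ' c + 1) :
    crossBlock P q x y n κ' a c = crossBlock P q x y n κ a c := by
  simp [crossBlock, ha, hc, hsa, hsc]

set_option maxHeartbeats 4000000 in
/-- The Yang–Baxter equation for a crossing moved through one column. -/
theorem cross_mul_columnRL {x y : F} {n : ℕ} {κ κ' : ℕ → ℕ} (hj : j ≠ 0) (hjm : j ≤ n + 1)
    (hP : P ≠ 0) (hy : y ≠ 0)
    (hX0 : ∀ a b, X a b ≠ 0) (hXd : X j j = - q ^ 2)
    (hX : ∀ a, a ≠ 0 → a ≤ n + 1 → a ≠ j → X a j * X j a = q ^ 2)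
    (hκ : κ j = 0) (hκ' : κ' j = n)
    (hs : ∀ c, c ≠ 0 → c ≤ n + 1 → c ≠ j → κ c = κ' c + 1 ∧ κ' c < n)
    (t s : ℕ) {a b c d : ℕ} (ha : a ≤ n + 1) (hb : b ≤ n + 1) (hc : c ≤ n + 1) (hd : d ≤ n + 1) :
    ∑ e ∈ Finset.range (n + 1 + 1), ∑ f ∈ Finset.range (n + 1 + 1),
        cross P q X x y n κ a b e f * columnRL P q X (n + 1) x y j t s e f c d =
      ∑ e ∈ Finset.range (n + 1 + 1), ∑ f ∈ Finset.range (n + 1 + 1),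
        columnLR P q X (n + 1) x y j t s a b e f * cross P q X x y n κ' e f c d := by
  rw [sum_cross_mul ha hb, sum_mul_cross hc hd]
  simp only [columnRL_eq x y hj hjm, columnLR_eq x y hj hjm]
  by_cases ht : t = 0 ∨ t = j
  swap
  · push Not at ht
    simp [vertexWeight_of_top _ _ ht.1 ht.2]
  by_cases hs' : s = 0 ∨ s = j
  swap
  · push Not at hs'
    simp [vertexWeight_of_bottom _ _ hs'.1 hs'.2]
  have ha' : a ∈ Finset.range (n + 1 + 1) := by simp; omega
  have hb' : b ∈ Finset.range (n + 1 + 1) := by simp; omega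
  have hc' : c ∈ Finset.range (n + 1 + 1) := by simp; omega
  have hd' : d ∈ Finset.range (n + 1 + 1) := by simp; omega
  have hj' : j ∈ Finset.range (n + 1 + 1) := by simp; omega
  have h0' : 0 ∈ Finset.range (n + 1 + 1) := by simp
  have hsc : ∀ c, c ≠ 0 → c ≤ n + 1 → c ≠ j → _ := fun c h1 h2 h3 =>
    crossBlock_shift_color (P := P) (q := q) (x := x) (y := y) hj hκ hκ' h1 h3 (hs c h1 h2 h3).1
      (hs c h1 h2 h3).2
  have hss : ∀ a c, a ≠ 0 → a ≠ j → c ≠ 0 → c ≠ j → a ≤ n + 1 → c ≤ n + 1 →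
      crossBlock P q x y n κ' a c = crossBlock P q x y n κ a c := fun a c h1 h2 h3 h4 h5 h6 =>
    crossBlock_shift_of_color h1 h3 (hs a h1 h5 h2).1 (hs c h3 h6 h4).1
  have e00 : crossBlock P q x y n κ 0 0 = P * ((q ^ 2) ^ 2 * (q ^ 2) ^ n * x - y) := by
    simp only [crossBlock, if_true]; ring
  have e00' : crossBlock P q x y n κ' 0 0 = P * ((q ^ 2) ^ 2 * (q ^ 2) ^ n * x - y) := by
    simp only [crossBlock, if_true]; ring
  have e0j : crossBlock P q x y n κ 0 j = (q ^ 2 - 1) * y * (q ^ 2) ^ n := by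
    simp [crossBlock, hj, hκ]
  have e0j' : crossBlock P q x y n κ' 0 j = (q ^ 2 - 1) * y := by
    simp [crossBlock, hj, hκ']
  have ej0 : crossBlock P q x y n κ j 0 = (q ^ 2 - 1) * x := by
    simp [crossBlock, hj, hκ]
  have ej0' : crossBlock P q x y n κ' j 0 = (q ^ 2 - 1) * x * (q ^ 2) ^ n := by
    simp [crossBlock, hj, hκ']
  have ejj : crossBlock P q x y n κ j j = (y - (q ^ 2) ^ n * x) / P := by
    simp [crossBlock, hj]
  have ejj' : crossBlock P q x y n κ' j j = (y - (q ^ 2) ^ n * x) / P := by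
    simp [crossBlock, hj]
  have hpow : (q ^ 2) ^ (n + 1) = q ^ 2 * (q ^ 2) ^ n := pow_succ' _ _
  generalize (q ^ 2) ^ n = W at *
  have hj2 := hj.symm
  by_cases hab : a = b <;> by_cases hcd : c = d <;>
  [(subst b; subst d); subst b; subst d; skip] <;>
  rcases ht with ht | ht <;> subst t <;> rcases hs' with hs' | hs' <;> subst s <;>
  simp only [vertexWeight_zero_zero_R, vertexWeight_occ_occ_R, vertexWeight_zero_occ_R,
    vertexWeight_occ_zero_R, vertexWeight_zero_zero_L, vertexWeight_occ_occ_L,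
    vertexWeight_zero_occ_L, vertexWeight_occ_zero_L, ne_eq, not_false_eq_true,
    mul_add, add_mul, mul_ite, ite_mul, mul_zero, zero_mul, Finset.sum_add_distrib,
    Finset.sum_ite_eq, Finset.sum_ite_eq', if_true, *, if_false]
  all_goals clear ha' hb' hc' hd'
  all_goals
    by_cases ha0 : a = 0 <;> by_cases haj : a = j <;>
    simp only [*, if_true, if_false, Finset.sum_ite_eq', Finset.sum_const_zero, add_zero,
      zero_add, ite_self]
  all_goals try grind [crossDiag]
  all_goals
    by_cases hc0 : c = 0 <;> by_cases hcj : c = j <;>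
    simp only [*, if_true, if_false, one_mul, mul_one, add_zero, zero_add, ite_self]
  all_goals try grind [crossDiag]
  all_goals
    have hscc := hsc c
    have hXa := hX0 a j
    try have hXb := hX0 j b
    clear hsc hss hs
    try simp only [crossDiag, hpow]
    split_ifs
  all_goals try grind

end YangBaxter

section ListProducts

lemma prod_ofFn_intertwine {R : Type*} [Monoid R] (M : ℕ → R) :
    ∀ {k : ℕ} (A B : Fin k → R), (∀ p : Fin k, M p * A p = B p * M (p + 1)) →
      M 0 * (List.ofFn A).prod = (List.ofFn B).prod * M k := by
  intro k
  induction k generalizing M with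
  | zero => simp
  | succ k ih =>
    intro A B h
    have h0 := h 0
    have ih' := ih (fun p => M (p + 1)) (fun p => A p.succ) (fun p => B p.succ)
      fun p => by simpa using h p.succ
    simp only [Fin.val_zero, zero_add] at h0 ih'
    rw [List.ofFn_succ, List.ofFn_succ, List.prod_cons, List.prod_cons, ← mul_assoc, h0,
      mul_assoc, ih', mul_assoc]

lemma sum_prod_ofFn {R V : Type*} [Semiring R] [Fintype V] :
    ∀ {k : ℕ} (C : Fin k → V → R),
      ∑ u : Fin k → V, (List.ofFn fun p => C p (u p)).prod =
        (List.ofFn fun p => ∑ v, C p v).prod := by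
  intro k
  induction k with
  | zero => simp
  | succ k ih =>
    intro C
    rw [← (Fin.consEquiv fun _ => V).sum_comp, Fintype.sum_prod_type]
    simp [List.ofFn_succ, Fin.consEquiv, ← Finset.mul_sum, ih fun p => C p.succ, Finset.sum_mul]

open scoped Kronecker in
lemma prod_ofFn_kronecker {F ι : Type*} [CommSemiring F] [Fintype ι] [DecidableEq ι] :
    ∀ {k : ℕ} (A B : Fin k → Matrix ι ι F),
      (List.ofFn A).prod ⊗ₖ (List.ofFn B).prod = (List.ofFn fun p => A p ⊗ₖ B p).prod := by
  intro k
  induction k with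
  | zero => simp
  | succ k ih =>
    intro A B
    simp [List.ofFn_succ, Matrix.mul_kronecker_mul, ih]

lemma prod_ofFn_apply {F ι : Type*} [CommSemiring F] [Fintype ι] [DecidableEq ι] :
    ∀ {k : ℕ} (A : Fin k → Matrix ι ι F) (e f : ι),
      (List.ofFn A).prod e f = ∑ g : Fin (k + 1) → ι,
        if g 0 = e ∧ g (Fin.last k) = f then ∏ p, A p (g p.castSucc) (g p.succ) else 0 := by
  intro k
  induction k with
  | zero =>
    intro A e f
    rw [← (Equiv.funUnique (Fin 1) ι).symm.sum_comp]
    simp [Matrix.one_apply, Fin.last, ite_and]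
  | succ k ih =>
    intro A e f
    rw [← (Fin.consEquiv fun _ => ι).sum_comp, Fintype.sum_prod_type]
    simp only [List.ofFn_succ, List.prod_cons, Matrix.mul_apply, Fin.consEquiv, Equiv.coe_fn_mk,
      Fin.cons_zero, ite_and, Fin.prod_univ_succ, Fin.castSucc_zero, Fin.cons_succ,
      ← Fin.succ_last, ← Fin.succ_castSucc, ih]
    simp only [Finset.sum_ite_irrel, Finset.sum_const_zero, Finset.sum_ite_eq', Finset.mem_univ,
      if_true, Finset.mul_sum]
    rw [Finset.sum_comm]
    refine Finset.sum_congr rfl fun g _ => ?_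
    simp

end ListProducts

section TwoRows
variable {F : Type*} [Field F]

/-- The transfer matrix of one row, indexed by its left and right boundary spins. -/
def rowMatrix (P q : F) (X : ℕ → ℕ → F) (m : ℕ) {k : ℕ} (col : Fin k → ℕ) (ty : RowType) (z : F)
    (T S : Fin k → Fin (m + 1)) : Matrix (Fin (m + 1)) (Fin (m + 1)) F :=
  (List.ofFn fun p => Matrix.of fun a c : Fin (m + 1) =>
    vertexWeight P q X ty z (col p) a (T p) c (S p)).prod

variable {P q : F} {X : ℕ → ℕ → F}

open scoped Kronecker in
lemma sum_rowMatrix_RL (m : ℕ) {k : ℕ} (col : Fin k → ℕ) (x y : F) (T S : Fin k → Fin (m + 1))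
    (a b c d : Fin (m + 1)) :
    ∑ u, rowMatrix P q X m col .R x T u a c * rowMatrix P q X m col .L y u S b d =
      (List.ofFn fun p => Matrix.of fun e f : Fin (m + 1) × Fin (m + 1) =>
        columnRL P q X m x y (col p) (T p) (S p) e.1 e.2 f.1 f.2).prod (a, b) (c, d) := by
  have h : ∀ p, (Matrix.of fun e f : Fin (m + 1) × Fin (m + 1) =>
      columnRL P q X m x y (col p) (T p) (S p) e.1 e.2 f.1 f.2) =
      ∑ v : Fin (m + 1), (Matrix.of fun a c : Fin (m + 1) =>
          vertexWeight P q X .R x (col p) a (T p) c v) ⊗ₖ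
        (Matrix.of fun a c : Fin (m + 1) => vertexWeight P q X .L y (col p) a v c (S p)) := by
    intro p
    ext e f
    simp [columnRL, Matrix.sum_apply, Matrix.kroneckerMap_apply, Finset.sum_range]
  simp only [h, ← sum_prod_ofFn, Matrix.sum_apply]
  refine Finset.sum_congr rfl fun u _ => ?_
  rw [← prod_ofFn_kronecker, Matrix.kroneckerMap_apply]
  rfl

open scoped Kronecker in
lemma sum_rowMatrix_LR (m : ℕ) {k : ℕ} (col : Fin k → ℕ) (x y : F) (T S : Fin k → Fin (m + 1))
    (a b c d : Fin (m + 1)) :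
    ∑ u, rowMatrix P q X m col .L y T u b d * rowMatrix P q X m col .R x u S a c =
      (List.ofFn fun p => Matrix.of fun e f : Fin (m + 1) × Fin (m + 1) =>
        columnLR P q X m x y (col p) (T p) (S p) e.1 e.2 f.1 f.2).prod (a, b) (c, d) := by
  have h : ∀ p, (Matrix.of fun e f : Fin (m + 1) × Fin (m + 1) =>
      columnLR P q X m x y (col p) (T p) (S p) e.1 e.2 f.1 f.2) =
      ∑ v : Fin (m + 1), (Matrix.of fun a c : Fin (m + 1) =>
          vertexWeight P q X .R x (col p) a v c (S p)) ⊗ₖ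
        (Matrix.of fun a c : Fin (m + 1) => vertexWeight P q X .L y (col p) a (T p) c v) := by
    intro p
    ext e f
    simp [columnLR, Matrix.sum_apply, Matrix.kroneckerMap_apply, Finset.sum_range, mul_comm]
  simp only [h, ← sum_prod_ofFn, Matrix.sum_apply]
  refine Finset.sum_congr rfl fun u _ => ?_
  rw [← prod_ofFn_kronecker, Matrix.kroneckerMap_apply, mul_comm]
  rfl

/-- The position of the color `c` in the cyclic order of colors, starting from the column color of
the column at position `p`. -/
def colorShift (n p c : ℕ) : ℕ := (c + n - p % (n + 1)) % (n + 1)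

lemma colorShift_self (n p : ℕ) : colorShift n p (p % (n + 1) + 1) = 0 := by
  have := Nat.mod_lt p (show n + 1 > 0 by omega)
  rw [colorShift, show p % (n + 1) + 1 + n - p % (n + 1) = n + 1 by omega, Nat.mod_self]

lemma colorShift_eq (n p c : ℕ) (hc : c ≤ n + 1) :
    colorShift n p c = if c ≤ p % (n + 1) then c + n - p % (n + 1) else c - 1 - p % (n + 1) := by
  have := Nat.mod_lt p (show n + 1 > 0 by omega)
  rw [colorShift]
  split_ifs with h
  · exact Nat.mod_eq_of_lt (by omega)
  · rw [show c + n - p % (n + 1) = c - 1 - p % (n + 1) + (n + 1) by omega, Nat.add_mod_right]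
    exact Nat.mod_eq_of_lt (by omega)

lemma succ_mod_eq (n p : ℕ) :
    (p + 1) % (n + 1) = if p % (n + 1) = n then 0 else p % (n + 1) + 1 := by
  rw [Nat.add_mod]
  split_ifs with h
  · rcases n with - | n
    · simp [Nat.mod_one]
    · simp [h]
  · have := Nat.mod_lt p (show n + 1 > 0 by omega)
    rw [Nat.mod_eq_of_lt (a := 1) (by omega), Nat.mod_eq_of_lt (by omega)]

lemma colorShift_succ_self (n p : ℕ) : colorShift n (p + 1) (p % (n + 1) + 1) = n := by
  have := Nat.mod_lt p (show n + 1 > 0 by omega)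
  rw [colorShift_eq _ _ _ (by omega), succ_mod_eq]
  split_ifs <;> omega

lemma colorShift_succ (n p c : ℕ) (h0 : c ≠ 0) (hc : c ≤ n + 1) (hp : c ≠ p % (n + 1) + 1) :
    colorShift n p c = colorShift n (p + 1) c + 1 ∧ colorShift n (p + 1) c < n := by
  have := Nat.mod_lt p (show n + 1 > 0 by omega)
  rw [colorShift_eq _ _ _ hc, colorShift_eq _ _ _ hc, succ_mod_eq]
  split_ifs <;> omega

/-- Two adjacent rows of distinct types can be exchanged. -/
theorem rowMatrix_swap {n k : ℕ} (x y : F) (hP : P ≠ 0) (hy : y ≠ 0)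
    (hX0 : ∀ a b, X a b ≠ 0) (hXd : ∀ j, X j j = -q ^ 2)
    (hX : ∀ a j, a ≠ 0 → a ≤ n + 1 → j ≠ 0 → j ≤ n + 1 → a ≠ j → X a j * X j a = q ^ 2)
    (hD : (q ^ 2) ^ (n + 1) * x - y ≠ 0)
    (col : Fin k → ℕ) (hcol : ∀ p, col p = p % (n + 1) + 1) (T S : Fin k → Fin (n + 1 + 1))
    {s s' : Fin (n + 1 + 1)} (hs : s ≠ 0) (hs' : s' ≠ 0) :
    ∑ u, rowMatrix P q X (n + 1) col .R x T u 0 s * rowMatrix P q X (n + 1) col .L y u S s' 0 =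
      ∑ u, rowMatrix P q X (n + 1) col .L y T u s' 0 *
        rowMatrix P q X (n + 1) col .R x u S 0 s := by
  rw [sum_rowMatrix_RL, sum_rowMatrix_LR]
  have key := prod_ofFn_intertwine
    (fun p => Matrix.of fun e f : Fin (n + 1 + 1) × Fin (n + 1 + 1) =>
      cross P q X x y n (colorShift n p) e.1 e.2 f.1 f.2)
    (fun p : Fin k => Matrix.of fun e f : Fin (n + 1 + 1) × Fin (n + 1 + 1) =>
      columnRL P q X (n + 1) x y (col p) (T p) (S p) e.1 e.2 f.1 f.2)
    (fun p : Fin k => Matrix.of fun e f : Fin (n + 1 + 1) × Fin (n + 1 + 1) =>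
      columnLR P q X (n + 1) x y (col p) (T p) (S p) e.1 e.2 f.1 f.2) fun p => by
    have := Nat.mod_lt (p : ℕ) (show n + 1 > 0 by omega)
    ext ⟨a, b⟩ ⟨c, d⟩
    have h := cross_mul_columnRL (P := P) (q := q) (X := X) (j := col p) (x := x) (y := y) (n := n)
      (κ := colorShift n p) (κ' := colorShift n (p + 1)) (by rw [hcol]; omega)
      (by rw [hcol]; omega) hP hy hX0 (hXd _)
      (fun a h1 h2 h3 => hX a _ h1 h2 (by rw [hcol]; omega) (by rw [hcol]; omega) h3)
      (by rw [hcol, colorShift_self]) (by rw [hcol, colorShift_succ_self])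
      (fun c h1 h2 h3 => colorShift_succ n p c h1 h2 (by rwa [hcol] at h3))
      (T p) (S p) (Nat.le_of_lt_succ a.2) (Nat.le_of_lt_succ b.2) (Nat.le_of_lt_succ c.2)
      (Nat.le_of_lt_succ d.2)
    simpa only [Finset.sum_range, Matrix.mul_apply, Matrix.of_apply, Fintype.sum_prod_type] using h
  have h1 : ∀ e : Fin (n + 1 + 1) × Fin (n + 1 + 1),
      cross P q X x y n (colorShift n 0) ((0 : Fin (n + 1 + 1)) : ℕ) s' e.1 e.2 =
        if e = (0, s') then (q ^ 2) ^ (n + 1) * x - y else 0 := by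
    have : (0 : ℕ) ≠ s' := fun h => hs' (Fin.ext h.symm)
    rintro ⟨e, f⟩
    simp only [cross, crossDiag, Fin.ext_iff, Prod.ext_iff, Fin.val_zero]
    grind
  have h2 : ∀ e : Fin (n + 1 + 1) × Fin (n + 1 + 1),
      cross P q X x y n (colorShift n k) e.1 e.2 s ((0 : Fin (n + 1 + 1)) : ℕ) =
        if e = (s, 0) then (q ^ 2) ^ (n + 1) * x - y else 0 := by
    have : (s : ℕ) ≠ 0 := fun h => hs (Fin.ext h)
    rintro ⟨e, f⟩
    simp only [cross, crossDiag, Fin.ext_iff, Prod.ext_iff, Fin.val_zero]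
    grind
  have h := congrFun (congrFun key (0, s')) (s, 0)
  simp only [Matrix.mul_apply, Matrix.of_apply, h1, h2, ite_mul, mul_ite, zero_mul, mul_zero,
    Finset.sum_ite_eq', Finset.mem_univ, if_true] at h
  rw [mul_comm] at h
  exact mul_right_cancel₀ hD h

end TwoRows

lemma prod_ofFn_congr_pair {R : Type*} [Monoid R] :
    ∀ (i : ℕ) {r : ℕ} (A B : Fin r → R) (hi : i + 1 < r),
      A ⟨i, by omega⟩ * A ⟨i + 1, hi⟩ = B ⟨i, by omega⟩ * B ⟨i + 1, hi⟩ →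
      (∀ t : Fin r, (t : ℕ) ≠ i → (t : ℕ) ≠ i + 1 → A t = B t) →
      (List.ofFn A).prod = (List.ofFn B).prod := by
  intro i
  induction i with
  | zero =>
    intro r A B hi h hne
    obtain ⟨r, rfl⟩ : ∃ k, r = k + 2 := ⟨r - 2, by omega⟩
    simp only [List.ofFn_succ, List.prod_cons, ← mul_assoc]
    congr 1
    congr 2
    funext t
    exact hne _ (by simp) (by simp)
  | succ i ih =>
    intro r A B hi h hne
    obtain ⟨r, rfl⟩ : ∃ k, r = k + 1 := ⟨r - 1, by omega⟩
    rw [List.ofFn_succ, List.ofFn_succ, List.prod_cons, List.prod_cons,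
      hne 0 (by simp) (by simp), ih (fun t => A t.succ) (fun t => B t.succ) (by omega) h]
    intro t h1 h2
    exact hne _ (by simpa using h1) (by simpa using h2)

section PartitionFunction
variable {m r : ℕ}

lemma wtVertex_eq_vertexWeight (ty : RowType) (z : K m r) (j a b c d : ℕ) :
    wtVertex m r ty z j a b c d =
      vertexWeight (Φv m r) (qv m r) (Xfrak m r) ty z j a b c d := by
  cases ty <;> rfl

/-- The transfer matrix of one row with its horizontal boundary condition, indexed by the spins of
the vertical edges above and below the row. -/
noncomputable def rowTransfer (m r Nc : ℕ) (ty : RowType) (z : K m r) (s : Fin (m + 1)) :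
    Matrix (Fin Nc → Fin (m + 1)) (Fin Nc → Fin (m + 1)) (K m r) :=
  Matrix.of fun T S =>
    match ty with
    | .R => rowMatrix (Φv m r) (qv m r) (Xfrak m r) m (colColor m Nc) .R z T S 0 s
    | .L => rowMatrix (Φv m r) (qv m r) (Xfrak m r) m (colColor m Nc) .L z T S s 0

open Classical in
lemma rowTransfer_apply (Nc : ℕ) (ty : RowType) (z : K m r) (s : Fin (m + 1))
    (T S : Fin Nc → Fin (m + 1)) :
    rowTransfer m r Nc ty z s T S = ∑ h : Fin (Nc + 1) → Fin (m + 1),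
      if (ty = RowType.R → (h 0 : ℕ) = 0 ∧ (h (Fin.last Nc) : ℕ) = s) ∧
          (ty = RowType.L → (h (Fin.last Nc) : ℕ) = 0 ∧ (h 0 : ℕ) = s)
      then ∏ p, wtVertex m r ty z (colColor m Nc p) (h p.castSucc) (T p) (h p.succ) (S p)
      else 0 := by
  cases ty <;> simp only [rowTransfer, Matrix.of_apply, rowMatrix, prod_ofFn_apply,
    wtVertex_eq_vertexWeight, Fin.ext_iff, Fin.val_zero, reduceCtorEq, false_imp_iff,
    true_imp_iff, and_true, true_and]
  exact Finset.sum_congr rfl fun h _ => if_congr and_comm rfl rfl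

lemma Z_eq_prod_rowTransfer (Nc : ℕ) (Θ : Fin r → RowType) (w : Fin r → K m r)
    (μ σ : Fin r → ℕ) (s : Fin r → Fin (m + 1)) (hs : ∀ t, (s t : ℕ) = σ t)
    (T : Fin Nc → Fin (m + 1))
    (hT : ∀ p, (T p : ℕ) = if ∃ t, μ t = colNum Nc p then colColor m Nc p else 0) :
    Z m r Nc Θ w μ σ =
      (List.ofFn fun t => rowTransfer m r Nc (Θ t) (w t) (s t)).prod T 0 := by
  classical
  rw [prod_ofFn_apply, Z, Fintype.sum_prod_type_right]
  refine Finset.sum_congr rfl fun v _ => ?_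
  simp only [rowTransfer_apply, Finset.prod_univ_sum, Fintype.piFinset_univ,
    Finset.prod_ite_zero, Finset.mem_univ, true_imp_iff]
  have hbc : ∀ h, bc m r Nc Θ μ σ (h, v) ↔ (v 0 = T ∧ v (Fin.last r) = 0) ∧
      ∀ t, (Θ t = RowType.R → (h t 0 : ℕ) = 0 ∧ (h t (Fin.last Nc) : ℕ) = s t) ∧
        (Θ t = RowType.L → (h t (Fin.last Nc) : ℕ) = 0 ∧ (h t 0 : ℕ) = s t) := by
    intro h
    simp only [bc, hs, ← hT, funext_iff, Fin.val_inj, Pi.zero_apply, and_assoc]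
  simp only [hbc, ite_and _ (∀ t, _), Finset.sum_ite_irrel, Finset.sum_const_zero, wtState]

lemma vr_ne_zero (v : Vars m r) : vr m r v ≠ 0 := by
  rw [vr, Ne, IsFractionRing.to_map_eq_zero_iff]
  exact MvPolynomial.X_ne_zero v

lemma Xfrak_ne_zero (a b : ℕ) : Xfrak m r a b ≠ 0 := by
  have hq : qv m r ≠ 0 := vr_ne_zero _
  have hX : ∀ idx, Xv m r idx ≠ 0 := fun _ => vr_ne_zero _
  unfold Xfrak
  split_ifs <;> simp [hq, hX]

lemma Xfrak_self (j : ℕ) : Xfrak m r j j = -qv m r ^ 2 := by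
  simp [Xfrak]

lemma Xfrak_mul_Xfrak {a b : ℕ} (ha : a ≠ 0) (ham : a ≤ m) (hb : b ≠ 0) (hbm : b ≤ m)
    (hab : a ≠ b) : Xfrak m r a b * Xfrak m r b a = qv m r ^ 2 := by
  have hX : ∀ idx, Xv m r idx ≠ 0 := fun _ => vr_ne_zero _
  unfold Xfrak
  rcases lt_or_gt_of_ne hab with h | h
  · rw [dif_pos ⟨by omega, h, hbm⟩, dif_neg (by omega), dif_pos ⟨by omega, h, hbm⟩]
    field_simp [hX]
  · rw [dif_neg (by omega), dif_pos ⟨by omega, h, ham⟩, dif_pos ⟨by omega, h, ham⟩]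
    field_simp [hX]

lemma pow_mul_zv_sub_zv_ne_zero (k : ℕ) {a b : Fin r} (hab : a ≠ b) :
    (qv m r ^ 2) ^ k * zv m r a - zv m r b ≠ 0 := by
  unfold qv zv vr
  rw [← map_pow, ← map_pow, ← map_mul, ← map_sub, Ne, IsFractionRing.to_map_eq_zero_iff]
  intro h
  classical
  have := congrArg (MvPolynomial.eval
    fun v : Vars m r => if v = Sum.inr (Sum.inr (Sum.inl b)) then (1 : ℚ) else 0) h
  simp [hab] at this

lemma colColor_eq {m : ℕ} (hm : 1 ≤ m) (N : ℕ) (p : Fin (N * m)) :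
    colColor m (N * m) p = p % m + 1 := by
  have hp := p.2
  have h1 := Nat.div_add_mod (p : ℕ) m
  have h2 := Nat.mod_lt (p : ℕ) hm
  have h3 : (p : ℕ) / m < N := Nat.div_lt_of_lt_mul (hp.trans_eq (mul_comm _ _))
  obtain ⟨l, hl⟩ := Nat.exists_eq_add_of_lt h3
  have h4 : colNum (N * m) p = m - 1 - p % m + m * l := by
    have : N * m = m * (p / m) + m + m * l := (congrArg (· * m) hl).trans (by ring)
    unfold colNum
    omega
  rw [colColor, h4, Nat.add_mul_mod_self_left, Nat.mod_eq_of_lt (by omega)]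
  omega

lemma rowTransfer_RL {m : ℕ} (hm : 1 ≤ m) (N : ℕ) {a b : Fin r} (hab : a ≠ b)
    {s s' : Fin (m + 1)} (hs : s ≠ 0) (hs' : s' ≠ 0) :
    rowTransfer m r (N * m) .R (zv m r a) s * rowTransfer m r (N * m) .L (zv m r b) s' =
      rowTransfer m r (N * m) .L (zv m r b) s' * rowTransfer m r (N * m) .R (zv m r a) s := by
  obtain ⟨n, rfl⟩ : ∃ n, m = n + 1 := ⟨m - 1, by omega⟩
  ext T S
  simp only [Matrix.mul_apply, rowTransfer, Matrix.of_apply]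
  exact rowMatrix_swap _ _ (vr_ne_zero _) (vr_ne_zero _) Xfrak_ne_zero Xfrak_self
    (fun _ _ h1 h2 h3 h4 h5 => Xfrak_mul_Xfrak h1 h2 h3 h4 h5)
    (pow_mul_zv_sub_zv_ne_zero _ hab) _ (colColor_eq hm N) T S hs hs'

end PartitionFunction

/-- Exchanging two adjacent rows of distinct types: the partition function
is unchanged if the row types, row parameters and horizontal boundary colors of rows `i`
and `i+1` are simultaneously interchanged. -/
theorem row_swap (m r N : ℕ) (hm : 1 ≤ m) (hr : 1 ≤ r) (hN : 1 ≤ N)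
    (μ : Fin r → ℕ) (hμdec : ∀ s t : Fin r, s < t → μ t < μ s)
    (hμN : ∀ t : Fin r, μ t < N * m)
    (σ : Fin r → ℕ) (hσ : ∀ t : Fin r, 1 ≤ σ t ∧ σ t ≤ m)
    (Θ : Fin r → RowType) (i : Fin r) (hi : (i : ℕ) + 1 < r)
    (hΘ : Θ i ≠ Θ ⟨(i : ℕ) + 1, hi⟩) :
    Z m r (N * m) Θ (zv m r) μ σ
      = Z m r (N * m)
          (Θ ∘ Equiv.swap i ⟨(i : ℕ) + 1, hi⟩)
          (zv m r ∘ Equiv.swap i ⟨(i : ℕ) + 1, hi⟩)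
          μ
          (σ ∘ Equiv.swap i ⟨(i : ℕ) + 1, hi⟩) := by
  set k : Fin r := ⟨(i : ℕ) + 1, hi⟩ with hk
  have hik : i ≠ k := fun h => by simpa [hk] using congrArg Fin.val h
  let s : Fin r → Fin (m + 1) := fun t => ⟨σ t, by have := hσ t; omega⟩
  have hs : ∀ t, s t ≠ 0 := fun t h => by
    have := hσ t
    have : σ t = 0 := congrArg Fin.val h
    omega
  let T : Fin (N * m) → Fin (m + 1) := fun p =>
    ⟨if ∃ t, μ t = colNum (N * m) p then colColor m (N * m) p else 0, by
      unfold colColor; split_ifs <;> omega⟩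
  rw [Z_eq_prod_rowTransfer _ _ _ _ σ s (fun _ => rfl) T (fun _ => rfl),
    Z_eq_prod_rowTransfer _ _ _ _ (σ ∘ Equiv.swap i k) (s ∘ Equiv.swap i k) (fun _ => rfl) T (fun _ => rfl)]
  rw [prod_ofFn_congr_pair i _ _ hi]
  · change rowTransfer m r _ (Θ i) (zv m r i) (s i) * rowTransfer m r _ (Θ k) (zv m r k) (s k) =
      rowTransfer m r _ (Θ (Equiv.swap i k i)) (zv m r (Equiv.swap i k i)) (s (Equiv.swap i k i)) *
      rowTransfer m r _ (Θ (Equiv.swap i k k)) (zv m r (Equiv.swap i k k)) (s (Equiv.swap i k k))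
    rw [Equiv.swap_apply_left, Equiv.swap_apply_right]
    rcases h1 : Θ i with _ | _ <;> rcases h2 : Θ k with _ | _
    · exact absurd (h1.trans h2.symm) hΘ
    · exact (rowTransfer_RL hm N hik.symm (hs k) (hs i)).symm
    · exact rowTransfer_RL hm N hik (hs i) (hs k)
    · exact absurd (h1.trans h2.symm) hΘ
  · intro t h1 h2
    have h3 : t ≠ i := fun h => h1 (congrArg Fin.val h)
    have h4 : t ≠ k := fun h => h2 (congrArg Fin.val h)
    simp [Equiv.swap_apply_of_ne_of_ne h3 h4]

end Lattice
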